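/- Let A, X, Y, Z be random variables satisfying the conditional independence constraints of the classical instrumental causal structure: I(A:X) = 0 and I(X:Y|AZ) = 0. Then every instance of the Ingleton inequality among these four variables holds, i.e., for every assignment of the four distinct variables A, X, Y, Z to the four slots of the Ingleton quantity, I_ING(X1,X2;X3,X4) ≥ 0. -/

import Mathlib

open Finset
open scoped Classical

/-- Probability that the random variable `X` (on the finite weighted sample space
`(Ω, μ)`) takes the value `b`. -/
noncomputable def pr {Ω β : Type*} [Fintype Ω] (μ : Ω → ℝ) (X : Ω → β) (b : β) : ℝ :=
  ∑ ω, if X ω = b then μ ω else 0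

/-- Shannon entropy of the random variable `X` on the finite weighted sample space
`(Ω, μ)`. -/
noncomputable def ent {Ω β : Type*} [Fintype Ω] [Fintype β] (μ : Ω → ℝ) (X : Ω → β) : ℝ :=
  ∑ b, Real.negMulLog (pr μ X b)

/-- Mutual information `I(X : Y)`. -/
noncomputable def mi {Ω β γ : Type*} [Fintype Ω] [Fintype β] [Fintype γ]
    (μ : Ω → ℝ) (X : Ω → β) (Y : Ω → γ) : ℝ :=
  ent μ X + ent μ Y - ent μ (fun ω => (X ω, Y ω))

/-- Conditional mutual information `I(X : Y | Z)`. -/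
noncomputable def cmi {Ω β γ δ : Type*} [Fintype Ω] [Fintype β] [Fintype γ] [Fintype δ]
    (μ : Ω → ℝ) (X : Ω → β) (Y : Ω → γ) (Z : Ω → δ) : ℝ :=
  ent μ (fun ω => (X ω, Z ω)) + ent μ (fun ω => (Y ω, Z ω)) - ent μ Z
    - ent μ (fun ω => (X ω, Y ω, Z ω))

/-- The Ingleton quantity `I_ING(S,T;U,V)`. -/
noncomputable def ing {Ω β γ δ ε : Type*} [Fintype Ω] [Fintype β] [Fintype γ] [Fintype δ]
    [Fintype ε] (μ : Ω → ℝ) (S : Ω → β) (T : Ω → γ) (U : Ω → δ) (V : Ω → ε) : ℝ :=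
  cmi μ S T U + cmi μ S T V + mi μ U V - mi μ S T

section Entropy

variable {Ω β γ δ ε : Type*} [Fintype Ω] {μ : Ω → ℝ}

lemma pr_nonneg (hμ : ∀ ω, 0 ≤ μ ω) (X : Ω → β) (b : β) : 0 ≤ pr μ X b :=
  Finset.sum_nonneg fun ω _ => by split_ifs <;> simp [hμ]

lemma pr_apply_pos (hμ : ∀ ω, 0 ≤ μ ω) (X : Ω → β) {ω : Ω} (hω : 0 < μ ω) :
    0 < pr μ X (X ω) :=
  Finset.sum_pos' (fun ω' _ => by split_ifs <;> simp [hμ]) ⟨ω, mem_univ ω, by simpa using hω⟩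

lemma sum_mul_comp [Fintype β] (μ : Ω → ℝ) (X : Ω → β) (f : β → ℝ) :
    ∑ ω, μ ω * f (X ω) = ∑ b, pr μ X b * f b := by
  simp only [pr, Finset.sum_mul, ite_mul, zero_mul]
  rw [Finset.sum_comm]
  simp

lemma sum_pr [Fintype β] (μ : Ω → ℝ) (X : Ω → β) : ∑ b, pr μ X b = ∑ ω, μ ω := by
  simpa using (sum_mul_comp μ X fun _ => 1).symm

lemma sum_pr_prodMk [Fintype β] (μ : Ω → ℝ) (X : Ω → β) (Z : Ω → δ) (z : δ) :
    ∑ x, pr μ (fun ω => (X ω, Z ω)) (x, z) = pr μ Z z := by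
  simp only [pr, Prod.mk.injEq, ite_and]
  rw [Finset.sum_comm]
  simp

lemma ent_eq_neg_sum [Fintype β] (μ : Ω → ℝ) (X : Ω → β) :
    ent μ X = -∑ ω, μ ω * Real.log (pr μ X (X ω)) := by
  rw [sum_mul_comp μ X fun b => Real.log (pr μ X b)]
  simp [ent, Real.negMulLog]

/-- Entropy only depends on the partition of the sample space induced by the variable. -/
lemma ent_congr [Fintype β] [Fintype γ] (μ : Ω → ℝ) {X : Ω → β} {Y : Ω → γ}
    (h : ∀ ω ω', X ω = X ω' ↔ Y ω = Y ω') : ent μ X = ent μ Y := by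
  simp only [ent_eq_neg_sum, pr, h]

lemma ent_unit (hμ1 : ∑ ω, μ ω = 1) : ent μ (fun _ => ()) = 0 := by
  simp [ent, pr, hμ1]

variable [Fintype β] [Fintype γ] [Fintype δ] [Fintype ε]

lemma sum_pr_mul_pr_div_pr (μ : Ω → ℝ) (X : Ω → β) (Y : Ω → γ) (Z : Ω → δ) :
    ∑ b : β × γ × δ, pr μ (fun ω => (X ω, Z ω)) (b.1, b.2.2) *
      pr μ (fun ω => (Y ω, Z ω)) b.2 / pr μ Z b.2.2 = ∑ ω, μ ω := by
  simp only [Fintype.sum_prod_type]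
  rw [Finset.sum_comm]
  simp_rw [Finset.sum_comm (s := (univ : Finset β)), ← Finset.sum_div, ← Finset.sum_mul,
    sum_pr_prodMk]
  rw [Finset.sum_comm]
  simp_rw [← Finset.sum_div, ← Finset.mul_sum, sum_pr_prodMk, mul_self_div_self]
  exact sum_pr μ Z

lemma cmi_nonneg (hμ : ∀ ω, 0 ≤ μ ω) (X : Ω → β) (Y : Ω → γ) (Z : Ω → δ) :
    0 ≤ cmi μ X Y Z := by
  let XZ := fun ω => (X ω, Z ω)
  let YZ := fun ω => (Y ω, Z ω)
  let XYZ := fun ω => (X ω, Y ω, Z ω)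
  let q : β × γ × δ → ℝ := fun b =>
    pr μ XZ (b.1, b.2.2) * pr μ YZ b.2 / pr μ Z b.2.2
  have hq : ∀ b, 0 ≤ q b := fun b =>
    div_nonneg (mul_nonneg (pr_nonneg hμ _ _) (pr_nonneg hμ _ _)) (pr_nonneg hμ _ _)
  have hle : ∑ ω, μ ω * (q (XYZ ω) / pr μ XYZ (XYZ ω)) ≤ ∑ ω, μ ω := by
    rw [sum_mul_comp μ XYZ fun b => q b / pr μ XYZ b, ← sum_pr_mul_pr_div_pr μ X Y Z]
    refine Finset.sum_le_sum fun b _ => ?_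
    rcases (pr_nonneg hμ XYZ b).eq_or_lt with h | h
    · rw [← h, zero_mul]
      exact hq b
    · rw [mul_div_cancel₀ _ h.ne']
  have hlog : ∀ ω, μ ω * (1 - q (XYZ ω) / pr μ XYZ (XYZ ω)) ≤
      μ ω * (Real.log (pr μ XYZ (XYZ ω)) + Real.log (pr μ Z (Z ω))
        - Real.log (pr μ XZ (XZ ω)) - Real.log (pr μ YZ (YZ ω))) := by
    intro ω
    rcases (hμ ω).eq_or_lt with h | h
    · simp [← h]
    · have h1 := pr_apply_pos hμ XYZ h
      have h2 := pr_apply_pos hμ Z h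
      have h3 := pr_apply_pos hμ XZ h
      have h4 := pr_apply_pos hμ YZ h
      have hqω : q (XYZ ω) = pr μ XZ (XZ ω) * pr μ YZ (YZ ω) / pr μ Z (Z ω) := rfl
      have hpos : 0 < q (XYZ ω) / pr μ XYZ (XYZ ω) := by rw [hqω]; positivity
      have key := Real.log_le_sub_one_of_pos hpos
      rw [hqω, Real.log_div (by positivity) h1.ne', Real.log_div (by positivity) h2.ne',
        Real.log_mul h3.ne' h4.ne', ← hqω] at key
      exact mul_le_mul_of_nonneg_left (by linarith) h.le
  have hsum := Finset.sum_le_sum fun ω (_ : ω ∈ univ) => hlog ω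
  simp only [mul_sub, mul_add, mul_one, Finset.sum_sub_distrib, Finset.sum_add_distrib] at hsum
  simp only [cmi, ent_eq_neg_sum]
  linarith

lemma mi_eq_cmi_unit (hμ1 : ∑ ω, μ ω = 1) (X : Ω → β) (Y : Ω → γ) :
    mi μ X Y = cmi μ X Y (fun _ => ()) := by
  rw [mi, cmi, ent_unit hμ1, ent_congr μ (X := fun ω => (X ω, ())) (Y := X) (by simp),
    ent_congr μ (X := fun ω => (Y ω, ())) (Y := Y) (by simp),
    ent_congr μ (X := fun ω => (X ω, Y ω, ())) (Y := fun ω => (X ω, Y ω)) (by simp)]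
  ring

lemma mi_nonneg (hμ : ∀ ω, 0 ≤ μ ω) (hμ1 : ∑ ω, μ ω = 1) (X : Ω → β) (Y : Ω → γ) :
    0 ≤ mi μ X Y :=
  mi_eq_cmi_unit hμ1 X Y ▸ cmi_nonneg hμ X Y _

lemma ent_swap (μ : Ω → ℝ) (X : Ω → β) (Y : Ω → γ) :
    ent μ (fun ω => (X ω, Y ω)) = ent μ (fun ω => (Y ω, X ω)) :=
  ent_congr μ fun _ _ => by simp [and_comm]

lemma ent_left_comm (μ : Ω → ℝ) (X : Ω → β) (Y : Ω → γ) (Z : Ω → δ) :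
    ent μ (fun ω => (X ω, Y ω, Z ω)) = ent μ (fun ω => (Y ω, X ω, Z ω)) :=
  ent_congr μ fun _ _ => by simp [and_left_comm]

lemma ent_rotate (μ : Ω → ℝ) (X : Ω → β) (Y : Ω → γ) (Z : Ω → δ) :
    ent μ (fun ω => (X ω, Y ω, Z ω)) = ent μ (fun ω => (Y ω, Z ω, X ω)) :=
  ent_congr μ fun _ _ => by simp only [Prod.mk.injEq]; tauto

lemma ent_right_comm (μ : Ω → ℝ) (X : Ω → β) (Y : Ω → γ) (Z : Ω → δ) :
    ent μ (fun ω => (X ω, Y ω, Z ω)) = ent μ (fun ω => (X ω, Z ω, Y ω)) :=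
  ent_congr μ fun _ _ => by simp [and_comm]

lemma mi_comm (μ : Ω → ℝ) (X : Ω → β) (Y : Ω → γ) : mi μ X Y = mi μ Y X := by
  rw [mi, mi, ent_swap μ X Y]
  ring

lemma cmi_comm (μ : Ω → ℝ) (X : Ω → β) (Y : Ω → γ) (Z : Ω → δ) :
    cmi μ X Y Z = cmi μ Y X Z := by
  rw [cmi, cmi, ent_left_comm μ X Y Z]
  ring

/-- `I(X : Y | Z) - I(X : Y) = I(X : Z | Y) - I(X : Z)`. -/
lemma cmi_sub_mi (μ : Ω → ℝ) (X : Ω → β) (Y : Ω → γ) (Z : Ω → δ) :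
    cmi μ X Y Z - mi μ X Y = cmi μ X Z Y - mi μ X Z := by
  simp only [cmi, mi]
  rw [ent_swap μ Z Y, ent_right_comm μ X Z Y]
  ring

lemma ing_swap_left (μ : Ω → ℝ) (S : Ω → β) (T : Ω → γ) (U : Ω → δ) (V : Ω → ε) :
    ing μ S T U V = ing μ T S U V := by
  rw [ing, ing, cmi_comm μ S T U, cmi_comm μ S T V, mi_comm μ S T]

lemma ing_swap_right (μ : Ω → ℝ) (S : Ω → β) (T : Ω → γ) (U : Ω → δ) (V : Ω → ε) :
    ing μ S T U V = ing μ S T V U := by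
  rw [ing, ing, mi_comm μ U V]
  ring

lemma ing_nonneg_of_mi_left (hμ : ∀ ω, 0 ≤ μ ω) (hμ1 : ∑ ω, μ ω = 1)
    {S : Ω → β} {T : Ω → γ} (U : Ω → δ) (V : Ω → ε) (h : mi μ S T = 0) :
    0 ≤ ing μ S T U V := by
  have h1 := cmi_nonneg hμ S T U
  have h2 := cmi_nonneg hμ S T V
  have h3 := mi_nonneg hμ hμ1 U V
  rw [ing]
  linarith

lemma ing_nonneg_of_mi_cross (hμ : ∀ ω, 0 ≤ μ ω) (hμ1 : ∑ ω, μ ω = 1)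
    {S : Ω → β} (T : Ω → γ) {U : Ω → δ} (V : Ω → ε) (h : mi μ S U = 0) :
    0 ≤ ing μ S T U V := by
  have h1 := cmi_nonneg hμ S U T
  have h2 := cmi_nonneg hμ S T V
  have h3 := mi_nonneg hμ hμ1 U V
  have h4 := cmi_sub_mi μ S T U
  rw [ing]
  linarith

/-- `I_ING(S,T;U,V) = I(S:U|T) + I(U:V|S) + I(S:T|UV) - I(U:S|VT)`. -/
lemma ing_eq_sub_cmi (μ : Ω → ℝ) (S : Ω → β) (T : Ω → γ) (U : Ω → δ) (V : Ω → ε) :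
    ing μ S T U V = cmi μ S U T + cmi μ U V S + cmi μ S T (fun ω => (U ω, V ω))
      - cmi μ U S (fun ω => (V ω, T ω)) := by
  have hSTUV := ent_congr μ (X := fun ω => (U ω, S ω, V ω, T ω))
    (Y := fun ω => (S ω, T ω, U ω, V ω)) fun _ _ => by simp only [Prod.mk.injEq]; tauto
  simp only [ing, cmi, mi]
  linarith [ent_swap μ U T, ent_swap μ V T, ent_swap μ U S, ent_swap μ V S,
    ent_right_comm μ S T U, ent_right_comm μ S T V, ent_rotate μ S U V, ent_rotate μ T U V]

lemma ing_nonneg_of_cmi (hμ : ∀ ω, 0 ≤ μ ω)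
    {S : Ω → β} {T : Ω → γ} {U : Ω → δ} {V : Ω → ε}
    (h : cmi μ U S (fun ω => (V ω, T ω)) = 0) : 0 ≤ ing μ S T U V := by
  have h1 := cmi_nonneg hμ S U T
  have h2 := cmi_nonneg hμ U V S
  have h3 := cmi_nonneg hμ S T (fun ω => (U ω, V ω))
  rw [ing_eq_sub_cmi, h]
  linarith

end Entropy

/-- **All Ingleton instances hold in the classical instrumental scenario.**
If `A, X, Y, Z` satisfy the conditional independence constraints of the classical
instrumental causal structure, `I(A:X) = 0` and `I(X:Y|AZ) = 0`, then every assignment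
of the four distinct variables to the four slots of the Ingleton quantity yields a
nonnegative value. -/
theorem instrumental_ingleton {Ω α β γ δ : Type*} [Fintype Ω]
    [Fintype α] [Fintype β] [Fintype γ] [Fintype δ]
    (μ : Ω → ℝ) (hμ0 : ∀ ω, 0 ≤ μ ω) (hμ1 : ∑ ω, μ ω = 1)
    (A : Ω → α) (X : Ω → β) (Y : Ω → γ) (Z : Ω → δ)
    (hAX : mi μ A X = 0)
    (hXY : cmi μ X Y (fun ω => (A ω, Z ω)) = 0) :
    0 ≤ ing μ A X Y Z ∧
    0 ≤ ing μ A X Z Y ∧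
    0 ≤ ing μ A Y X Z ∧
    0 ≤ ing μ A Y Z X ∧
    0 ≤ ing μ A Z X Y ∧
    0 ≤ ing μ A Z Y X ∧
    0 ≤ ing μ X A Y Z ∧
    0 ≤ ing μ X A Z Y ∧
    0 ≤ ing μ X Y A Z ∧
    0 ≤ ing μ X Y Z A ∧
    0 ≤ ing μ X Z A Y ∧
    0 ≤ ing μ X Z Y A ∧
    0 ≤ ing μ Y A X Z ∧
    0 ≤ ing μ Y A Z X ∧
    0 ≤ ing μ Y X A Z ∧
    0 ≤ ing μ Y X Z A ∧
    0 ≤ ing μ Y Z A X ∧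
    0 ≤ ing μ Y Z X A ∧
    0 ≤ ing μ Z A X Y ∧
    0 ≤ ing μ Z A Y X ∧
    0 ≤ ing μ Z X A Y ∧
    0 ≤ ing μ Z X Y A ∧
    0 ≤ ing μ Z Y A X ∧
    0 ≤ ing μ Z Y X A
    := by
  have hXA : mi μ X A = 0 := mi_comm μ A X ▸ hAX
  have hAXYZ := ing_nonneg_of_mi_left hμ0 hμ1 Y Z hAX
  have hAYXZ := ing_nonneg_of_mi_cross hμ0 hμ1 Y Z hAX
  have hAZXY := ing_nonneg_of_mi_cross hμ0 hμ1 Z Y hAX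
  have hXYAZ := ing_nonneg_of_mi_cross hμ0 hμ1 Y Z hXA
  have hXZAY := ing_nonneg_of_mi_cross hμ0 hμ1 Z Y hXA
  have hYZXA := ing_nonneg_of_cmi hμ0 hXY
  rw [ing_swap_left μ X A Y Z, ing_swap_left μ X A Z Y, ing_swap_left μ Y A X Z,
    ing_swap_left μ Y A Z X, ing_swap_left μ Y X A Z, ing_swap_left μ Y X Z A,
    ing_swap_left μ Z A X Y, ing_swap_left μ Z A Y X, ing_swap_left μ Z X A Y,
    ing_swap_left μ Z X Y A, ing_swap_left μ Z Y A X, ing_swap_left μ Z Y X A,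
    ing_swap_right μ A X Z Y, ing_swap_right μ A Y Z X, ing_swap_right μ A Z Y X,
    ing_swap_right μ X Y Z A, ing_swap_right μ X Z Y A, ing_swap_right μ Y Z A X]
  simp only [hAXYZ, hAYXZ, hAZXY, hXYAZ, hXZAY, hYZXA, and_self]
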